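/- (Mazur's inequality) For every b ∈ GL_n(L) and every O-lattice M in N = Lⁿ, one has ν̄_b ≤ inv(M, Φ(M)) in the dominance order, where (N, Φ) = (Lⁿ, b∘σ). Equivalently: for μ ∈ (ℤⁿ)₊, if there exists an O-lattice M in N with inv(M, Φ(M)) = μ, then ν̄_b ≤ μ. -/

import Mathlib

/-!
Isocrystals over `L = Frac(W(k))`, `k` an algebraic closure of `𝔽_p`:
for `b ∈ GL_n(L)` the isocrystal `(N, Φ) = (Lⁿ, b ∘ σ)`, `O = W(k)`-lattices in `N`,
the relative position `inv(M, M')` of two lattices, the dominance order, and the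
Newton (slope) vector of an isocrystal via its Dieudonné–Manin slope decomposition.
-/

noncomputable section

open scoped Isocrystal

section IsocrystalSetup

variable (p : ℕ) [Fact p.Prime]
variable (k : Type) [Field k] [IsAlgClosed k] [CharP k p]
variable (n : ℕ)

/-- `σ`, the Frobenius automorphism of `L = K(p, k) = Frac(W(k))`. -/
abbrev frobL : K(p, k) ≃+* K(p, k) := WittVector.FractionRing.frobenius p k

/-- The `σ`-linear bijection `Φ = b ∘ σ` on `N = Lⁿ` attached to `b ∈ GL_n(L)`. -/
def isocFrob (b : GL (Fin n) (K(p, k))) (v : Fin n → K(p, k)) : Fin n → K(p, k) :=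
  (b : Matrix (Fin n) (Fin n) (K(p, k))).mulVec fun i => frobL p k (v i)

/-- `M` is an `O = W(k)`-lattice in `N = Lⁿ`: the `O`-span of an `L`-basis. -/
def IsLattice (M : Submodule (WittVector p k) (Fin n → K(p, k))) : Prop :=
  ∃ e : Fin n → (Fin n → K(p, k)),
    LinearIndependent (K(p, k)) e ∧ M = Submodule.span (WittVector p k) (Set.range e)

/-- The image `Φ(M)` of a lattice under the `σ`-linear map `Φ`, as an `O`-submodule. -/
def latImage (b : GL (Fin n) (K(p, k)))
    (M : Submodule (WittVector p k) (Fin n → K(p, k))) :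
    Submodule (WittVector p k) (Fin n → K(p, k)) :=
  Submodule.span (WittVector p k) (isocFrob p k n b '' (M : Set (Fin n → K(p, k))))

/-- The relative position `inv(M, M') = μ ∈ ℤⁿ` of two lattices (elementary divisor
theorem): there is an `O`-basis `e₁, …, e_n` of `M` such that
`p^{μ₁} e₁, …, p^{μ_n} e_n` is an `O`-basis of `M'`. -/
def RelPos (M M' : Submodule (WittVector p k) (Fin n → K(p, k))) (μ : Fin n → ℤ) : Prop :=
  ∃ e : Fin n → (Fin n → K(p, k)), LinearIndependent (K(p, k)) e ∧
    M = Submodule.span (WittVector p k) (Set.range e) ∧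
    M' = Submodule.span (WittVector p k)
      (Set.range fun i => (p : K(p, k)) ^ (μ i) • e i)

/-- Partial sum `ν₁ + … + ν_r` of a vector `ν`. -/
def partialSum (ν : Fin n → ℚ) (r : ℕ) : ℚ :=
  ∑ i ∈ Finset.univ.filter (fun i : Fin n => (i : ℕ) < r), ν i

/-- The dominance order on `ℚⁿ`: all proper partial sums are `≤`, total sums equal. -/
def DomLE (ν ν' : Fin n → ℚ) : Prop :=
  (∀ r : ℕ, r < n → partialSum n ν r ≤ partialSum n ν' r) ∧
    partialSum n ν n = partialSum n ν' n

/-- A subspace `P` of the isocrystal `(Lⁿ, Φ_b)` is isoclinic of slope `λ = s/r`: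
it admits an `O`-lattice `M` (a finitely generated `O`-submodule spanning `P`
over `L`) with `Φ^r(M) = p^s M`. -/
def IsIsoclinicOfSlope (b : GL (Fin n) (K(p, k)))
    (P : Submodule (K(p, k)) (Fin n → K(p, k))) (lam : ℚ) : Prop :=
  ∃ (r : ℕ) (s : ℤ), 0 < r ∧ lam = (s : ℚ) / (r : ℚ) ∧
    ∃ M : Submodule (WittVector p k) (Fin n → K(p, k)),
      (M : Set (Fin n → K(p, k))) ⊆ (P : Set (Fin n → K(p, k))) ∧
      Submodule.span (K(p, k)) (M : Set (Fin n → K(p, k))) = P ∧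
      (∃ S : Finset (Fin n → K(p, k)),
        M = Submodule.span (WittVector p k) (S : Set (Fin n → K(p, k)))) ∧
      Submodule.span (WittVector p k)
          ((isocFrob p k n b)^[r] '' (M : Set (Fin n → K(p, k)))) =
        Submodule.span (WittVector p k)
          ((fun x => (p : K(p, k)) ^ s • x) '' (M : Set (Fin n → K(p, k))))

/-- `ν ∈ (ℚⁿ)₊` is the Newton vector of the isocrystal `(Lⁿ, Φ_b)`: `ν` is
weakly decreasing and there is a `Φ_b`-stable slope decomposition
`Lⁿ = ⊕_λ N_λ` with `N_λ` isoclinic of slope `λ` and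
`dim N_λ = #{i : ν_i = λ}` (Dieudonné–Manin). -/
def IsNewtonVector (b : GL (Fin n) (K(p, k))) (ν : Fin n → ℚ) : Prop :=
  (∀ i j : Fin n, i ≤ j → ν j ≤ ν i) ∧
  ∃ P : ℚ → Submodule (K(p, k)) (Fin n → K(p, k)),
    iSupIndep P ∧ (⨆ lam, P lam) = ⊤ ∧
    (∀ lam, isocFrob p k n b '' (P lam : Set (Fin n → K(p, k))) ⊆ P lam) ∧
    (∀ lam, Module.finrank (K(p, k)) (P lam) =
      (Finset.univ.filter fun i : Fin n => ν i = lam).card) ∧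
    (∀ lam, P lam = ⊥ ∨ IsIsoclinicOfSlope p k n b (P lam) lam)

end IsocrystalSetup

section MazurHelpers

variable {p : ℕ} [Fact p.Prime]
variable {k : Type} [Field k] [IsAlgClosed k] [CharP k p]
variable {n : ℕ}

open Matrix

/-- `x ∈ p^a O`. -/
def InI (p : ℕ) [Fact p.Prime] (k : Type) [Field k] [IsAlgClosed k] [CharP k p]
    (a : ℤ) (x : K(p, k)) : Prop :=
  ∃ y : WittVector p k, x = (p : K(p, k)) ^ a * algebraMap (WittVector p k) (K(p, k)) y

/-- `x ∈ p^a Oˣ`. -/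
def HasV (p : ℕ) [Fact p.Prime] (k : Type) [Field k] [IsAlgClosed k] [CharP k p]
    (a : ℤ) (x : K(p, k)) : Prop :=
  ∃ y : (WittVector p k)ˣ,
    x = (p : K(p, k)) ^ a * algebraMap (WittVector p k) (K(p, k)) (y : WittVector p k)

lemma pL_ne : (p : K(p, k)) ≠ 0 := by
  have h := WittVector.p_nonzero p k
  intro h0
  apply h
  apply IsFractionRing.injective (WittVector p k) (K(p, k))
  simpa using h0

lemma InI.mul {a b : ℤ} {x y : K(p, k)} (hx : InI p k a x) (hy : InI p k b y) :
    InI p k (a + b) (x * y) := by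
  obtain ⟨u, rfl⟩ := hx
  obtain ⟨v, rfl⟩ := hy
  refine ⟨u * v, ?_⟩
  rw [zpow_add₀ pL_ne, map_mul]; ring

lemma InI.zero {a : ℤ} : InI p k a 0 := ⟨0, by simp⟩

lemma InI.add {a : ℤ} {x y : K(p, k)} (hx : InI p k a x) (hy : InI p k a y) :
    InI p k a (x + y) := by
  obtain ⟨u, rfl⟩ := hx
  obtain ⟨v, rfl⟩ := hy
  exact ⟨u + v, by rw [map_add]; ring⟩

lemma InI.sum {ι : Type*} {a : ℤ} (s : Finset ι) {f : ι → K(p, k)}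
    (h : ∀ i ∈ s, InI p k a (f i)) : InI p k a (∑ i ∈ s, f i) :=
  Finset.sum_induction _ _ (fun _ _ => InI.add) InI.zero h

lemma InI.one : InI p k 0 1 := ⟨1, by simp⟩

lemma InI.prod {ι : Type*} (s : Finset ι) {f : ι → K(p, k)}
    (h : ∀ i ∈ s, InI p k 0 (f i)) : InI p k 0 (∏ i ∈ s, f i) :=
  Finset.prod_induction _ _ (fun _ _ hx hy => by simpa using InI.mul hx hy) InI.one h

lemma InI.mono {a b : ℤ} (hab : a ≤ b) {x : K(p, k)} (hx : InI p k b x) : InI p k a x := by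
  obtain ⟨u, rfl⟩ := hx
  refine ⟨p ^ (b - a).toNat * u, ?_⟩
  have : ((b - a).toNat : ℤ) = b - a := Int.toNat_of_nonneg (by omega)
  rw [map_mul, map_pow, map_natCast, ← zpow_natCast, this, ← mul_assoc, ← zpow_add₀ pL_ne]
  congr 2; ring

lemma InI.pow (a : ℤ) : InI p k a ((p : K(p, k)) ^ a) := ⟨1, by simp⟩

lemma frobL_algebraMap (y : WittVector p k) :
    frobL p k (algebraMap _ _ y) = algebraMap _ _ (WittVector.frobeniusEquiv p k y) := by
  simp [frobL, WittVector.FractionRing.frobenius]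

lemma InI.frob {a : ℤ} {x : K(p, k)} (hx : InI p k a x) : InI p k a (frobL p k x) := by
  obtain ⟨u, rfl⟩ := hx
  exact ⟨_, by rw [map_mul, map_zpow₀, map_natCast, frobL_algebraMap]⟩

lemma HasV.frob {a : ℤ} {x : K(p, k)} (hx : HasV p k a x) : HasV p k a (frobL p k x) := by
  obtain ⟨u, rfl⟩ := hx
  exact ⟨Units.map (WittVector.frobeniusEquiv p k).toRingHom.toMonoidHom u, by
    rw [map_mul, map_zpow₀, map_natCast, frobL_algebraMap]; rfl⟩

lemma HasV.mul {a b : ℤ} {x y : K(p, k)} (hx : HasV p k a x) (hy : HasV p k b y) :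
    HasV p k (a + b) (x * y) := by
  obtain ⟨u, rfl⟩ := hx
  obtain ⟨v, rfl⟩ := hy
  refine ⟨u * v, ?_⟩
  rw [zpow_add₀ pL_ne, Units.val_mul, map_mul]; ring

lemma le_of_InI {a b : ℤ} {x : K(p, k)} (hx : HasV p k b x) (h : InI p k a x) : a ≤ b := by
  obtain ⟨u, rfl⟩ := hx
  obtain ⟨v, hv⟩ := h
  by_contra hlt
  push Not at hlt
  have h1 : (algebraMap (WittVector p k) (K(p, k))) u
      = algebraMap _ _ ((p : WittVector p k) ^ (a - b).toNat * v) := by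
    have : ((a - b).toNat : ℤ) = a - b := Int.toNat_of_nonneg (by omega)
    rw [map_mul, map_pow, map_natCast, ← zpow_natCast, this, zpow_sub₀ pL_ne]
    have := zpow_ne_zero b (pL_ne (p := p) (k := k))
    field_simp
    rw [← hv]; ring
  have h2 := IsFractionRing.injective (WittVector p k) (K(p, k)) h1
  have h3 : (p : WittVector p k) ∣ u := by
    rw [h2]
    exact Dvd.dvd.mul_right (dvd_pow_self _ (by omega)) _
  exact (WittVector.irreducible p (k := k)).not_isUnit (isUnit_of_dvd_unit h3 u.isUnit)

lemma HasV.inI {a : ℤ} {x : K(p, k)} (hx : HasV p k a x) : InI p k a x := by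
  obtain ⟨u, rfl⟩ := hx; exact ⟨_, rfl⟩

lemma HasV.unique {a b : ℤ} {x : K(p, k)} (hx : HasV p k a x) (hy : HasV p k b x) : a = b :=
  le_antisymm (le_of_InI hy hx.inI) (le_of_InI hx hy.inI)

lemma HasV.pow (a : ℤ) : HasV p k a ((p : K(p, k)) ^ a) := ⟨1, by simp⟩

lemma exists_HasV {x : K(p, k)} (hx : x ≠ 0) : ∃ a, HasV p k a x := by
  obtain ⟨y, z, hz, rfl⟩ := IsFractionRing.div_surjective (A := WittVector p k) x
  have hz0 : z ≠ 0 := nonZeroDivisors.ne_zero hz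
  have hy0 : y ≠ 0 := by rintro rfl; simp at hx
  obtain ⟨m, u, rfl⟩ := WittVector.exists_eq_pow_p_mul' y hy0
  obtain ⟨l, v, rfl⟩ := WittVector.exists_eq_pow_p_mul' z hz0
  refine ⟨m - l, u * v⁻¹, ?_⟩
  have hv : algebraMap (WittVector p k) (K(p, k)) (v : WittVector p k)
      * algebraMap (WittVector p k) (K(p, k)) (v⁻¹ : (WittVector p k)ˣ) = 1 := by
    rw [← map_mul, Units.mul_inv, map_one]
  have hv0 : algebraMap (WittVector p k) (K(p, k)) (v : WittVector p k) ≠ 0 :=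
    left_ne_zero_of_mul_eq_one hv
  have := pL_ne (p := p) (k := k)
  rw [Units.val_mul, zpow_sub₀ pL_ne]
  simp only [map_mul, map_pow, map_natCast, zpow_natCast]
  field_simp
  exact hv.symm

lemma exists_int_pow {ι κ : Type*} [Fintype ι] [Fintype κ] (C : Matrix ι κ K(p, k)) :
    ∃ s : ℤ, ∀ i j, InI p k s (C i j) := by
  have h : ∀ i j, ∃ s : ℤ, InI p k s (C i j) := by
    intro i j
    by_cases h : C i j = 0
    · exact ⟨0, h ▸ InI.zero⟩
    · obtain ⟨a, ha⟩ := exists_HasV h; exact ⟨a, ha.inI⟩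
  choose s hs using h
  obtain ⟨t, ht⟩ := (Set.finite_range fun x : ι × κ => s x.1 x.2).bddBelow
  exact ⟨t, fun i j => (hs i j).mono (ht ⟨(i, j), rfl⟩)⟩

/-- All minors of shape `ι` lie in `p^a O`. -/
def HasMinors (ι : Type) [Fintype ι] [DecidableEq ι] (A : Matrix (Fin n) (Fin n) K(p, k))
    (a : ℤ) : Prop := ∀ g h : ι → Fin n, InI p k a (A.submatrix g h).det

variable {ι : Type} [Fintype ι] [DecidableEq ι]

lemma HasMinors.transpose {A : Matrix (Fin n) (Fin n) K(p, k)} {a : ℤ}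
    (h : HasMinors ι A a) : HasMinors ι Aᵀ a := by
  intro g h'
  have := h h' g
  rwa [← Matrix.det_transpose, Matrix.transpose_submatrix] at this

lemma HasMinors.frob {A : Matrix (Fin n) (Fin n) K(p, k)} {a : ℤ}
    (h : HasMinors ι A a) : HasMinors ι (A.map (frobL p k)) a := by
  intro g h'
  have := (h g h').frob
  rw [RingEquiv.map_det] at this
  exact this

lemma HasMinors.zpow_smul {A : Matrix (Fin n) (Fin n) K(p, k)} {a : ℤ} (s : ℤ)
    (h : HasMinors ι A a) :
    HasMinors ι ((p : K(p, k)) ^ s • A) (a + s * Fintype.card ι) := by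
  intro g h'
  rw [Matrix.submatrix_smul, Pi.smul_apply, Pi.smul_apply, Matrix.det_smul, ← zpow_natCast,
    ← _root_.zpow_mul, add_comm]
  exact (InI.pow _).mul (h g h')

lemma HasMinors.int_mul {X A : Matrix (Fin n) (Fin n) K(p, k)} {a : ℤ}
    (hX : ∀ i j, InI p k 0 (X i j)) (h : HasMinors ι A a) : HasMinors ι (X * A) a := by
  intro g h'
  have key : ((X * A).submatrix g h').det
      = ∑ f : ι → Fin n, (∏ i, X (g i) (f i)) * (A.submatrix f h').det := by
    have h1 : (X * A).submatrix g h' = fun i => ∑ j, X (g i) j • (fun l => A j (h' l)) := by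
      ext i l
      simp [Matrix.mul_apply, Finset.sum_apply]
    change Matrix.detRowAlternating ((X * A).submatrix g h') = _
    rw [h1]
    have := (Matrix.detRowAlternating (n := ι) (R := K(p, k))).toMultilinearMap.map_sum
      (fun i j => X (g i) j • (fun l => A j (h' l)))
    refine this.trans (Finset.sum_congr rfl fun f _ => ?_)
    have h2 := (Matrix.detRowAlternating (n := ι) (R := K(p, k))).toMultilinearMap.map_smul_univ
      (fun i => X (g i) (f i)) (fun i l => A (f i) (h' l))
    exact h2
  rw [key]
  refine InI.sum _ fun f _ => ?_
  simpa using (InI.prod Finset.univ fun i _ => hX (g i) (f i)).mul (h f h')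

lemma HasMinors.mul_int {X A : Matrix (Fin n) (Fin n) K(p, k)} {a : ℤ}
    (hX : ∀ i j, InI p k 0 (X i j)) (h : HasMinors ι A a) : HasMinors ι (A * X) a := by
  have := (HasMinors.int_mul (X := Xᵀ) (fun i j => hX j i) h.transpose).transpose
  rwa [← Matrix.transpose_mul, Matrix.transpose_transpose] at this

lemma smul_int {s : ℤ} {X : Matrix (Fin n) (Fin n) K(p, k)} (hX : ∀ i j, InI p k s (X i j)) :
    ∀ i j, InI p k 0 (((p : K(p, k)) ^ (-s) • X) i j) := by
  intro i j
  simpa using (InI.pow (p := p) (k := k) (-s)).mul (hX i j)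

lemma smul_smul_p (s : ℤ) (X : Matrix (Fin n) (Fin n) K(p, k)) :
    X = (p : K(p, k)) ^ s • ((p : K(p, k)) ^ (-s) • X) := by
  rw [smul_smul, ← zpow_add₀ pL_ne]; simp

lemma HasMinors.mul_left {X A : Matrix (Fin n) (Fin n) K(p, k)} {a s : ℤ}
    (hX : ∀ i j, InI p k s (X i j)) (h : HasMinors ι A a) :
    HasMinors ι (X * A) (a + s * Fintype.card ι) := by
  rw [smul_smul_p s X, Matrix.smul_mul]
  exact (h.int_mul (smul_int hX)).zpow_smul s

lemma HasMinors.mul_right {X A : Matrix (Fin n) (Fin n) K(p, k)} {a s : ℤ}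
    (hX : ∀ i j, InI p k s (X i j)) (h : HasMinors ι A a) :
    HasMinors ι (A * X) (a + s * Fintype.card ι) := by
  rw [smul_smul_p s X, Matrix.mul_smul]
  exact (h.mul_int (smul_int hX)).zpow_smul s

/-- The diagonal matrix `p^μ`. -/
def pDiag (p : ℕ) [Fact p.Prime] (k : Type) [Field k] [IsAlgClosed k] [CharP k p]
    (μ : Fin n → ℤ) : Matrix (Fin n) (Fin n) K(p, k) :=
  Matrix.diagonal fun i => (p : K(p, k)) ^ μ i

lemma prod_zpow_p {κ : Type*} (s : Finset κ) (f : κ → ℤ) :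
    ∏ i ∈ s, (p : K(p, k)) ^ f i = (p : K(p, k)) ^ (∑ i ∈ s, f i) := by
  classical
  induction s using Finset.induction_on with
  | empty => simp
  | insert a s ha ih => rw [Finset.prod_insert ha, Finset.sum_insert ha, ih, zpow_add₀ pL_ne]

lemma HasMinors.diag_mul {A : Matrix (Fin n) (Fin n) K(p, k)} {a c : ℤ} {μ : Fin n → ℤ}
    (hc : ∀ g : ι → Fin n, Function.Injective g → c ≤ ∑ i, μ (g i))
    (h : HasMinors ι A a) : HasMinors ι (pDiag p k μ * A) (c + a) := by
  intro g h'
  by_cases hg : Function.Injective g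
  · have h1 : ((pDiag p k μ * A).submatrix g h')
        = Matrix.of fun i j => (p : K(p, k)) ^ μ (g i) * (A.submatrix g h') i j := by
      ext i j
      simp [pDiag, Matrix.diagonal_mul]
    rw [h1, Matrix.det_mul_column, prod_zpow_p]
    exact ((InI.pow _).mono (hc g hg)).mul (h g h')
  · simp only [Function.Injective, not_forall] at hg
    obtain ⟨i, j, hij, hne⟩ := hg
    rw [Matrix.det_zero_of_row_eq hne]
    · exact InI.zero
    · ext l; simp [hij]

lemma HasMinors.one : HasMinors ι (1 : Matrix (Fin n) (Fin n) K(p, k)) 0 := by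
  intro g h
  rw [Matrix.det_apply]
  refine InI.sum _ fun π _ => ?_
  rw [Units.smul_def, zsmul_eq_mul]
  have h1 : InI p k 0 (((Equiv.Perm.sign π : ℤˣ) : ℤ) : K(p, k)) :=
    ⟨(((Equiv.Perm.sign π : ℤˣ) : ℤ) : WittVector p k), by simp⟩
  have h2 : InI p k 0 (∏ i, (1 : Matrix (Fin n) (Fin n) K(p, k)).submatrix g h (π i) i) := by
    refine InI.prod _ fun i _ => ?_
    rw [Matrix.submatrix_apply, Matrix.one_apply]
    split_ifs
    · exact InI.one
    · exact InI.zero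
  simpa only [add_zero] using h1.mul h2

/-- `Φ` on matrices, columnwise. -/
def PhiM (b : GL (Fin n) (K(p, k))) (X : Matrix (Fin n) (Fin n) K(p, k)) :
    Matrix (Fin n) (Fin n) K(p, k) := (b : Matrix (Fin n) (Fin n) K(p, k)) * X.map (frobL p k)

lemma PhiM_mul (b : GL (Fin n) (K(p, k))) (X Y : Matrix (Fin n) (Fin n) K(p, k)) :
    PhiM b (X * Y) = PhiM b X * Y.map (frobL p k) := by
  rw [PhiM, PhiM, Matrix.map_mul, Matrix.mul_assoc]

lemma PhiM_iter_mul (b : GL (Fin n) (K(p, k))) (m : ℕ) (X Y : Matrix (Fin n) (Fin n) K(p, k)) :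
    (PhiM b)^[m] (X * Y)
      = (PhiM b)^[m] X * (fun Z : Matrix (Fin n) (Fin n) K(p, k) => Z.map (frobL p k))^[m] Y := by
  induction m with
  | zero => rfl
  | succ m ih => simp only [Function.iterate_succ_apply', ih, PhiM_mul]

lemma frob_iter_InI {s : ℤ} {Y : Matrix (Fin n) (Fin n) K(p, k)} (hY : ∀ i j, InI p k s (Y i j))
    (m : ℕ) : ∀ i j, InI p k s
      ((fun Z : Matrix (Fin n) (Fin n) K(p, k) => Z.map (frobL p k))^[m] Y i j) := by
  induction m with
  | zero => exact hY
  | succ m ih =>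
    intro i j
    rw [Function.iterate_succ_apply']
    exact (ih i j).frob

lemma PhiM_iter_minors {b : GL (Fin n) (K(p, k))} {E Y : Matrix (Fin n) (Fin n) K(p, k)}
    {c : ℤ} {μ : Fin n → ℤ}
    (hc : ∀ g : ι → Fin n, Function.Injective g → c ≤ ∑ i, μ (g i))
    (hY : ∀ i j, InI p k 0 (Y i j)) (hE : PhiM b E = E * pDiag p k μ * Y) (m : ℕ) :
    ∃ A, (PhiM b)^[m] E = E * A ∧ HasMinors ι A (m * c) := by
  induction m with
  | zero => exact ⟨1, by simp, by simpa using HasMinors.one⟩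
  | succ m ih =>
    obtain ⟨A, h1, h2⟩ := ih
    refine ⟨pDiag p k μ * (Y * A.map (frobL p k)), ?_, ?_⟩
    · rw [Function.iterate_succ_apply', h1, PhiM_mul, hE]
      simp only [Matrix.mul_assoc]
    · have := (h2.frob.int_mul hY).diag_mul hc
      convert this using 1
      push_cast; ring

lemma minors_le {b : GL (Fin n) (K(p, k))} {E Y F : Matrix (Fin n) (Fin n) K(p, k)}
    {c : ℤ} {μ q : Fin n → ℤ} (R : ℕ)
    (hc : ∀ g : ι → Fin n, Function.Injective g → c ≤ ∑ i, μ (g i))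
    (hY : ∀ i j, InI p k 0 (Y i j)) (hE : PhiM b E = E * pDiag p k μ * Y)
    (hEu : IsUnit E) (hFu : IsUnit F)
    (hF : ∀ t : ℕ, ∃ Z : Matrix (Fin n) (Fin n) K(p, k), (∀ i j, InI p k 0 (Z i j)) ∧
      F * pDiag p k (fun i => t * q i) = (PhiM b)^[R * t] F * Z)
    (v : ι → Fin n) (hv : Function.Injective v) : R * c ≤ ∑ i, q (v i) := by
  obtain ⟨C, hC⟩ : ∃ C, F = E * C := ⟨E⁻¹ * F, by
    rw [← Matrix.mul_assoc, Matrix.mul_nonsing_inv _ ((Matrix.isUnit_iff_isUnit_det _).1 hEu),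
      Matrix.one_mul]⟩
  obtain ⟨G, hG⟩ : ∃ G, G * F = E := ⟨E * F⁻¹, by
    rw [Matrix.mul_assoc, Matrix.nonsing_inv_mul _ ((Matrix.isUnit_iff_isUnit_det _).1 hFu),
      Matrix.mul_one]⟩
  obtain ⟨C', hC'⟩ : ∃ C', C' * C = 1 := by
    refine ⟨F⁻¹ * E, ?_⟩
    rw [Matrix.mul_assoc, ← hC, Matrix.nonsing_inv_mul _ ((Matrix.isUnit_iff_isUnit_det _).1 hFu)]
  obtain ⟨s, hs⟩ := exists_int_pow C
  obtain ⟨s', hs'⟩ := exists_int_pow C'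
  have main : ∀ t : ℕ, (R * t : ℕ) * c + s * Fintype.card ι + s' * Fintype.card ι
      ≤ t * ∑ i, q (v i) := by
    intro t
    obtain ⟨Z, hZ, h1⟩ := hF t
    obtain ⟨A, hA, h2⟩ := PhiM_iter_minors (ι := ι) hc hY hE (R * t)
    rw [hC, PhiM_iter_mul, hA, Matrix.mul_assoc, Matrix.mul_assoc, Matrix.mul_assoc] at h1
    have h3 := hEu.mul_left_cancel h1
    have h4 : pDiag p k (fun i => t * q i) = C' * (A * (fun Z : Matrix (Fin n) (Fin n) K(p, k) =>
        Z.map (frobL p k))^[R * t] C * Z) := by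
      rw [Matrix.mul_assoc A, ← h3, ← Matrix.mul_assoc, hC', Matrix.one_mul]
    have h5 := ((h2.mul_right (frob_iter_InI hs (R * t))).mul_int hZ).mul_left hs'
    rw [← h4] at h5
    have h6 := h5 v v
    rw [pDiag, Matrix.submatrix_diagonal _ _ hv, Matrix.det_diagonal] at h6
    simp only [Function.comp_apply] at h6
    rw [prod_zpow_p, ← Finset.mul_sum] at h6
    exact le_of_InI (HasV.pow _) h6
  by_contra hlt
  push Not at hlt
  set Q := ∑ i, q (v i)
  set K := s * (Fintype.card ι : ℤ) + s' * Fintype.card ι with hK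
  have h7 := main (K.natAbs + 1)
  push_cast at h7
  have h8 : -K ≤ |K| := neg_le_abs K
  nlinarith [abs_nonneg K]

lemma PhiM_det {b : GL (Fin n) (K(p, k))} {c : ℤ}
    (hb : HasV p k c (b : Matrix (Fin n) (Fin n) K(p, k)).det)
    {X : Matrix (Fin n) (Fin n) K(p, k)} {a : ℤ} (hX : HasV p k a X.det) (m : ℕ) :
    HasV p k (m * c + a) ((PhiM b)^[m] X).det := by
  induction m with
  | zero => simpa using hX
  | succ m ih =>
    rw [Function.iterate_succ_apply', PhiM, Matrix.det_mul]
    have h := ih.frob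
    rw [RingEquiv.map_det] at h
    have := hb.mul h
    rw [show ((m + 1 : ℕ) : ℤ) * c + a = c + (m * c + a) by push_cast; ring]
    exact this

lemma pDiag_det (μ : Fin n → ℤ) : HasV p k (∑ i, μ i) (pDiag p k μ).det := by
  rw [pDiag, Matrix.det_diagonal, prod_zpow_p]
  exact HasV.pow _

lemma total_eq {b : GL (Fin n) (K(p, k))} {E Y F Z : Matrix (Fin n) (Fin n) K(p, k)}
    {μ q : Fin n → ℤ} (R : ℕ)
    (hY : HasV p k 0 Y.det) (hE : PhiM b E = E * pDiag p k μ * Y)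
    (hEu : IsUnit E) (hFu : IsUnit F) (hZ : HasV p k 0 Z.det)
    (hF : F * pDiag p k q = (PhiM b)^[R] F * Z) : R * ∑ i, μ i = ∑ i, q i := by
  have hne : ∀ {X : Matrix (Fin n) (Fin n) K(p, k)}, IsUnit X → X.det ≠ 0 := fun h =>
    ((Matrix.isUnit_iff_isUnit_det _).1 h).ne_zero
  obtain ⟨c, hc⟩ := exists_HasV (hne b.isUnit)
  obtain ⟨a, ha⟩ := exists_HasV (hne hEu)
  obtain ⟨d, hd⟩ := exists_HasV (hne hFu)
  have h1 := PhiM_det hc ha 1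
  rw [Function.iterate_one, hE, Matrix.det_mul, Matrix.det_mul] at h1
  have h2 := h1.unique ((ha.mul (pDiag_det μ)).mul hY)
  have h3 := (PhiM_det hc hd R).mul hZ
  rw [← Matrix.det_mul, ← hF, Matrix.det_mul] at h3
  have h4 := h3.unique (hd.mul (pDiag_det q))
  have h5 : c = ∑ i, μ i := by push_cast at h2; linarith
  rw [← h5]; linarith

lemma span_image_span {V : Type*} [AddCommGroup V] [Module (WittVector p k) V] (ψ : V → V)
    (h0 : ψ 0 = 0)
    (hadd : ∀ x y, ψ (x + y) = ψ x + ψ y)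
    (hsm : ∀ (o : WittVector p k) x, ∃ o' : WittVector p k, ψ (o • x) = o' • ψ x) (S : Set V) :
    Submodule.span (WittVector p k) (ψ '' (Submodule.span (WittVector p k) S : Set V))
      = Submodule.span (WittVector p k) (ψ '' S) := by
  apply le_antisymm
  · rw [Submodule.span_le]
    rintro _ ⟨x, hx, rfl⟩
    induction hx using Submodule.span_induction with
    | mem x h => exact Submodule.subset_span ⟨x, h, rfl⟩
    | zero => rw [h0]; exact Submodule.zero_mem _
    | add x y _ _ hx hy => rw [hadd]; exact Submodule.add_mem _ hx hy
    | smul o x _ hx =>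
      obtain ⟨o', ho⟩ := hsm o x
      rw [ho]; exact Submodule.smul_mem _ _ hx
  · exact Submodule.span_mono (Set.image_mono Submodule.subset_span)

lemma isocFrob_add (b : GL (Fin n) (K(p, k))) (x y : Fin n → K(p, k)) :
    isocFrob p k n b (x + y) = isocFrob p k n b x + isocFrob p k n b y := by
  rw [isocFrob, isocFrob, isocFrob, ← Matrix.mulVec_add]
  congr 1; ext i; simp

lemma isocFrob_smul (b : GL (Fin n) (K(p, k))) (a : K(p, k)) (x : Fin n → K(p, k)) :
    isocFrob p k n b (a • x) = frobL p k a • isocFrob p k n b x := by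
  rw [isocFrob, isocFrob, ← Matrix.mulVec_smul]
  congr 1; ext i; simp

lemma iter_add (b : GL (Fin n) (K(p, k))) (m : ℕ) (x y : Fin n → K(p, k)) :
    (isocFrob p k n b)^[m] (x + y) = (isocFrob p k n b)^[m] x + (isocFrob p k n b)^[m] y := by
  induction m with
  | zero => rfl
  | succ m ih => simp only [Function.iterate_succ_apply', ih, isocFrob_add]

lemma iter_zero (b : GL (Fin n) (K(p, k))) (m : ℕ) :
    (isocFrob p k n b)^[m] 0 = 0 := by
  have := iter_add b m 0 0
  simpa using this

lemma iter_smul (b : GL (Fin n) (K(p, k))) (m : ℕ) (o : WittVector p k) (x : Fin n → K(p, k)) :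
    ∃ o' : WittVector p k,
      (isocFrob p k n b)^[m] (o • x) = o' • (isocFrob p k n b)^[m] x := by
  induction m with
  | zero => exact ⟨o, rfl⟩
  | succ m ih =>
    obtain ⟨o', h⟩ := ih
    refine ⟨WittVector.frobeniusEquiv p k o', ?_⟩
    rw [Function.iterate_succ_apply', Function.iterate_succ_apply', h,
      ← algebraMap_smul (K(p, k)) o', isocFrob_smul, frobL_algebraMap, algebraMap_smul]

lemma iter_zpow_smul (b : GL (Fin n) (K(p, k))) (m : ℕ) (s : ℤ) (x : Fin n → K(p, k)) :
    (isocFrob p k n b)^[m] ((p : K(p, k)) ^ s • x)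
      = (p : K(p, k)) ^ s • (isocFrob p k n b)^[m] x := by
  induction m with
  | zero => rfl
  | succ m ih =>
    rw [Function.iterate_succ_apply', Function.iterate_succ_apply', ih, isocFrob_smul,
      map_zpow₀, map_natCast]

lemma span_iter (b : GL (Fin n) (K(p, k))) (m : ℕ) (S : Set (Fin n → K(p, k))) :
    Submodule.span (WittVector p k) ((isocFrob p k n b)^[m] ''
      (Submodule.span (WittVector p k) S : Set (Fin n → K(p, k))))
      = Submodule.span (WittVector p k) ((isocFrob p k n b)^[m] '' S) :=
  span_image_span _ (iter_zero b m) (iter_add b m) (iter_smul b m) S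

lemma span_zpow (s : ℤ) (S : Set (Fin n → K(p, k))) :
    Submodule.span (WittVector p k) ((fun x => (p : K(p, k)) ^ s • x) ''
      (Submodule.span (WittVector p k) S : Set (Fin n → K(p, k))))
      = Submodule.span (WittVector p k) ((fun x => (p : K(p, k)) ^ s • x) '' S) :=
  span_image_span _ (smul_zero _) (smul_add _) (fun o x => ⟨o, smul_comm _ _ _⟩) S

lemma isoclinic_iter {b : GL (Fin n) (K(p, k))} {S : Set (Fin n → K(p, k))} {r : ℕ} {s : ℤ}
    (h : Submodule.span (WittVector p k) ((isocFrob p k n b)^[r] '' S) =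
        Submodule.span (WittVector p k) ((fun x => (p : K(p, k)) ^ s • x) '' S)) (t : ℕ) :
    Submodule.span (WittVector p k) ((isocFrob p k n b)^[r * t] '' S) =
        Submodule.span (WittVector p k) ((fun x => (p : K(p, k)) ^ (t * s) • x) '' S) := by
  induction t with
  | zero => simp
  | succ t ih =>
    have h1 : (isocFrob p k n b)^[r * (t + 1)] '' S
        = (isocFrob p k n b)^[r * t] '' ((isocFrob p k n b)^[r] '' S) := by
      rw [← Set.image_comp, ← Function.iterate_add, Nat.mul_succ]
    have h2 : (isocFrob p k n b)^[r * t] '' ((fun x => (p : K(p, k)) ^ s • x) '' S)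
        = (fun x => (p : K(p, k)) ^ s • x) '' ((isocFrob p k n b)^[r * t] '' S) := by
      rw [← Set.image_comp, ← Set.image_comp]
      refine Set.image_congr fun x _ => ?_
      exact iter_zpow_smul b _ s x
    rw [h1, ← span_iter, h, span_iter, h2, ← span_zpow, ih, span_zpow, ← Set.image_comp]
    congr 1
    refine Set.image_congr fun x _ => ?_
    simp only [Function.comp_apply, smul_smul]
    rw [← zpow_add₀ pL_ne]
    congr 2
    push_cast; ring

/-- The matrix with columns `e`. -/
def colM (e : Fin n → Fin n → K(p, k)) : Matrix (Fin n) (Fin n) K(p, k) :=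
  Matrix.of fun i j => e j i

lemma colM_isUnit {e : Fin n → Fin n → K(p, k)} (he : LinearIndependent K(p, k) e) :
    IsUnit (colM e) := by
  rw [← Matrix.linearIndependent_cols_iff_isUnit]
  exact he

lemma PhiM_colM (b : GL (Fin n) (K(p, k))) (e : Fin n → Fin n → K(p, k)) (m : ℕ) :
    (PhiM b)^[m] (colM e) = colM fun i => (isocFrob p k n b)^[m] (e i) := by
  induction m with
  | zero => rfl
  | succ m ih =>
    rw [Function.iterate_succ_apply', ih]
    ext i j
    simp only [Function.iterate_succ_apply', colM, PhiM, Matrix.mul_apply, isocFrob,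
      Matrix.mulVec, dotProduct, Matrix.of_apply, Matrix.map_apply]

lemma colM_pDiag (e : Fin n → Fin n → K(p, k)) (q : Fin n → ℤ) :
    colM e * pDiag p k q = colM fun i => (p : K(p, k)) ^ q i • e i := by
  ext i j
  simp [colM, pDiag, Matrix.mul_diagonal, mul_comm]

lemma colM_le {e f : Fin n → Fin n → K(p, k)}
    (h : Submodule.span (WittVector p k) (Set.range f)
      ≤ Submodule.span (WittVector p k) (Set.range e)) :
    ∃ Y : Matrix (Fin n) (Fin n) (WittVector p k),
      colM f = colM e * Y.map (algebraMap (WittVector p k) K(p, k)) := by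
  have h1 : ∀ j, ∃ c : Fin n → WittVector p k, ∑ i, c i • e i = f j := fun j =>
    (Submodule.mem_span_range_iff_exists_fun _).1 (h (Submodule.subset_span ⟨j, rfl⟩))
  choose c hc using h1
  refine ⟨Matrix.of fun i j => c j i, ?_⟩
  ext i j
  simp only [colM, Matrix.of_apply, Matrix.mul_apply, Matrix.map_apply, ← hc j, Finset.sum_apply]
  refine Finset.sum_congr rfl fun l _ => ?_
  rw [Pi.smul_apply, Algebra.smul_def, mul_comm]

lemma colM_eq {e f : Fin n → Fin n → K(p, k)} (he : IsUnit (colM e))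
    (h : Submodule.span (WittVector p k) (Set.range f)
      = Submodule.span (WittVector p k) (Set.range e)) :
    ∃ Y : Matrix (Fin n) (Fin n) K(p, k), (∀ i j, InI p k 0 (Y i j)) ∧ HasV p k 0 Y.det ∧
      colM f = colM e * Y := by
  obtain ⟨Y, hY⟩ := colM_le h.le
  obtain ⟨Z, hZ⟩ := colM_le h.ge
  refine ⟨_, fun i j => ⟨Y i j, by simp⟩, ?_, hY⟩
  have h1 : colM e * (Y * Z).map (algebraMap (WittVector p k) K(p, k)) = colM e * 1 := by
    rw [Matrix.map_mul, ← Matrix.mul_assoc, ← hY, ← hZ, Matrix.mul_one]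
  have h2 := congrArg Matrix.det (he.mul_left_cancel h1)
  have h3 : algebraMap (WittVector p k) K(p, k) (Y.det * Z.det) = 1 := by
    rw [← Matrix.det_mul, RingHom.map_det]
    simpa using h2
  have h4 : Y.det * Z.det = 1 :=
    IsFractionRing.injective (WittVector p k) (K(p, k)) (by rw [h3, map_one])
  refine ⟨Units.mkOfMulEqOne _ _ h4, ?_⟩
  rw [zpow_zero, one_mul]
  exact (RingHom.map_det (algebraMap (WittVector p k) K(p, k)) Y).symm

/-- A lattice in `P` has a basis of the right size. -/
lemma exists_lattice_basis {P : Submodule K(p, k) (Fin n → K(p, k))}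
    {M : Submodule (WittVector p k) (Fin n → K(p, k))}
    (hMP : Submodule.span K(p, k) (M : Set (Fin n → K(p, k))) = P)
    {S : Finset (Fin n → K(p, k))}
    (hS : M = Submodule.span (WittVector p k) (S : Set (Fin n → K(p, k))))
    {κ : Type} [Fintype κ] (hκ : Module.finrank K(p, k) P = Fintype.card κ) :
    ∃ f : κ → Fin n → K(p, k), Submodule.span (WittVector p k) (Set.range f) = M := by
  have hfg : M.FG := ⟨S, hS.symm⟩
  have : Module.Finite (WittVector p k) M := Module.Finite.iff_fg.2 hfg
  have : Module.IsTorsionFree (WittVector p k) (Fin n → K(p, k)) := inferInstance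
  have : Module.IsTorsionFree (WittVector p k) M := inferInstance
  have : Module.Free (WittVector p k) M := inferInstance
  let B := Module.finBasis (WittVector p k) M
  let g : Fin (Module.finrank (WittVector p k) M) → Fin n → K(p, k) := fun i => (B i : _)
  have hspan : Submodule.span (WittVector p k) (Set.range g) = M := by
    have h1 : Set.range g = M.subtype '' Set.range B := by
      rw [← Set.range_comp]; rfl
    rw [h1, Submodule.span_image, B.span_eq, Submodule.map_top, Submodule.range_subtype]
  have hli : LinearIndependent (WittVector p k) g :=
    B.linearIndependent.map' M.subtype (Submodule.ker_subtype _)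
  have hliL : LinearIndependent K(p, k) g :=
    (LinearIndependent.iff_fractionRing (WittVector p k) K(p, k)).1 hli
  have hspanL : Submodule.span K(p, k) (Set.range g) = P := by
    have h1 := Submodule.span_span_of_tower (WittVector p k) K(p, k) (Set.range g)
    rw [hspan, hMP] at h1
    exact h1.symm
  have hcard : Module.finrank (WittVector p k) M = Fintype.card κ := by
    rw [← hκ, ← hspanL, finrank_span_eq_card hliL, Fintype.card_fin]
  let eqv : κ ≃ Fin (Module.finrank (WittVector p k) M) :=
    Fintype.equivFinOfCardEq hcard.symm
  exact ⟨g ∘ eqv, by rw [eqv.surjective.range_comp, hspan]⟩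

lemma newton_basis {b : GL (Fin n) (K(p, k))} {ν : Fin n → ℚ} (hν : IsNewtonVector p k n b ν) :
    ∃ (R : ℕ) (q : Fin n → ℤ) (f : Fin n → Fin n → K(p, k)), 0 < R ∧
      LinearIndependent K(p, k) f ∧ (∀ i, (q i : ℚ) = R * ν i) ∧
      ∀ t : ℕ, Submodule.span (WittVector p k)
          (Set.range fun i => (p : K(p, k)) ^ (t * q i) • f i)
        = Submodule.span (WittVector p k)
          (Set.range fun i => (isocFrob p k n b)^[R * t] (f i)) := by
  obtain ⟨-, P, -, htop, -, hdim, hiso⟩ := hν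
  have hdim' : ∀ lam, Module.finrank K(p, k) (P lam) = Fintype.card {i : Fin n // ν i = lam} := by
    intro lam
    rw [hdim, Fintype.card_subtype]
  have hall : ∀ lam, ∃ (r : ℕ) (s : ℤ) (f : {i : Fin n // ν i = lam} → Fin n → K(p, k)),
      0 < r ∧ ((∃ i, ν i = lam) → lam = (s : ℚ) / r) ∧
      Submodule.span K(p, k) (Set.range f) = P lam ∧
      Submodule.span (WittVector p k) ((isocFrob p k n b)^[r] '' (Set.range f)) =
        Submodule.span (WittVector p k) ((fun x => (p : K(p, k)) ^ s • x) '' (Set.range f)) := by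
    intro lam
    rcases hiso lam with h | ⟨r, s, hr, hl, M, -, hMP, ⟨S, hS⟩, hM⟩
    · have h1 := hdim' lam
      rw [h, finrank_bot] at h1
      have := Fintype.card_eq_zero_iff.1 h1.symm
      refine ⟨1, 0, fun i => isEmptyElim i, one_pos, ?_, ?_, ?_⟩
      · rintro ⟨i, hi⟩
        exact isEmptyElim (⟨i, hi⟩ : {i : Fin n // ν i = lam})
      · rw [h, Set.range_eq_empty, Submodule.span_empty]
      · simp [Set.range_eq_empty]
    · obtain ⟨f, hf⟩ := exists_lattice_basis hMP hS (hdim' lam)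
      refine ⟨r, s, f, hr, fun _ => hl, ?_, ?_⟩
      · rw [← hMP, ← hf, Submodule.span_span_of_tower]
      · rw [← span_iter, ← span_zpow, hf, hM]
  choose r s f hr hl hsp hF using hall
  let R : ℕ := ∏ i, r (ν i)
  have hdvd : ∀ i, ∃ w : ℕ, R = r (ν i) * w := fun i =>
    Finset.dvd_prod_of_mem (fun i => r (ν i)) (Finset.mem_univ i)
  have hRpos : 0 < R := Finset.prod_pos fun i _ => hr _
  -- work with quotients depending on the slope only
  let w : ℚ → ℕ := fun lam => R / r lam
  have hw : ∀ i, R = r (ν i) * w (ν i) := fun i => (Nat.mul_div_cancel' (hdvd i)).symm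
  have hrng : ∀ (ψ : ℚ → (Fin n → K(p, k)) → (Fin n → K(p, k))),
      Submodule.span (WittVector p k) (Set.range fun i => ψ (ν i) (f (ν i) ⟨i, rfl⟩))
        = ⨆ i, Submodule.span (WittVector p k) (ψ (ν i) '' Set.range (f (ν i))) := by
    intro ψ
    rw [← Submodule.span_iUnion]
    congr 1
    ext x
    simp only [Set.mem_range, Set.mem_iUnion, Set.mem_image]
    constructor
    · rintro ⟨i, rfl⟩
      exact ⟨i, _, ⟨_, rfl⟩, rfl⟩
    · rintro ⟨i, _, ⟨⟨j, hj⟩, rfl⟩, rfl⟩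
      refine ⟨j, ?_⟩
      have aux : ∀ lam (h : ν j = lam), ψ (ν j) (f (ν j) ⟨j, rfl⟩) = ψ lam (f lam ⟨j, h⟩) := by
        rintro _ rfl; rfl
      exact aux _ hj
  refine ⟨R, fun i => w (ν i) * s (ν i), fun i => f (ν i) ⟨i, rfl⟩, hRpos, ?_, ?_, ?_⟩
  · apply linearIndependent_of_top_le_span_of_card_eq_finrank
    · rw [← htop]
      refine iSup_le fun lam => ?_
      rw [← hsp lam, Submodule.span_le]
      rintro _ ⟨⟨i, rfl⟩, rfl⟩
      exact Submodule.subset_span ⟨i, rfl⟩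
    · simp
  · intro i
    have h1 := hl (ν i) ⟨i, rfl⟩
    have h2 : (R : ℚ) = r (ν i) * w (ν i) := by exact_mod_cast hw i
    have h3 : (r (ν i) : ℚ) ≠ 0 := by exact_mod_cast (hr (ν i)).ne'
    rw [h2]
    push_cast
    rw [eq_div_iff h3] at h1
    rw [← h1]; ring
  · intro t
    rw [hrng (fun lam x => (p : K(p, k)) ^ ((t : ℤ) * (w lam * s lam)) • x),
      hrng (fun lam x => (isocFrob p k n b)^[R * t] x)]
    refine iSup_congr fun i => ?_
    have := isoclinic_iter (hF (ν i)) (w (ν i) * t)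
    rw [← mul_assoc, ← hw i] at this
    rw [this]
    congr 2
    ext x
    congr 3
    push_cast; ring

lemma sum_tail_le {μ : Fin n → ℤ} (hμ : ∀ i j : Fin n, i ≤ j → μ j ≤ μ i) {r : ℕ} (hr : r < n)
    (g : {i : Fin n // ¬ (i : ℕ) < r} → Fin n) (hg : Function.Injective g) :
    ∑ i : {i : Fin n // ¬ (i : ℕ) < r}, μ i ≤ ∑ i, μ (g i) := by
  classical
  set t := μ ⟨r, hr⟩ with ht
  let T : Finset (Fin n) := Finset.univ.filter fun i => ¬ (i : ℕ) < r
  let S : Finset (Fin n) := Finset.univ.image g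
  have hT : ∀ i ∈ T, μ i - t ≤ 0 := by
    intro i hi
    have : r ≤ (i : ℕ) := by simpa [T] using hi
    have := hμ ⟨r, hr⟩ i this
    omega
  have hT' : ∀ i, i ∉ T → 0 ≤ μ i - t := by
    intro i hi
    have : (i : ℕ) < r := by simpa [T] using hi
    have := hμ i ⟨r, hr⟩ this.le
    omega
  have h1 : ∑ i ∈ T, (μ i - t) ≤ ∑ i ∈ S, (μ i - t) := by
    calc ∑ i ∈ T, (μ i - t) = ∑ i, if i ∈ T then μ i - t else 0 := by simp
      _ ≤ ∑ i, if i ∈ S then μ i - t else 0 := by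
        refine Finset.sum_le_sum fun i _ => ?_
        by_cases h : i ∈ T <;> by_cases h' : i ∈ S <;> simp only [h, h', if_true, if_false]
        · exact le_rfl
        · exact hT i h
        · exact hT' i h
        · exact le_rfl
      _ = _ := by simp
  have h2 : ∑ i ∈ T, (μ i - t) = ∑ i : {i : Fin n // ¬ (i : ℕ) < r}, (μ i - t) :=
    Finset.sum_subtype T (by simp [T]) _
  have h3 : ∑ i ∈ S, (μ i - t) = ∑ i, (μ (g i) - t) :=
    Finset.sum_image fun x _ y _ h => hg h
  rw [h2, h3, Finset.sum_sub_distrib, Finset.sum_sub_distrib] at h1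
  linarith

lemma partialSum_eq (ν : Fin n → ℚ) (r : ℕ) :
    partialSum n ν r = ∑ i, ν i - ∑ i : {i : Fin n // ¬ (i : ℕ) < r}, ν i := by
  rw [partialSum, ← Finset.sum_filter_add_sum_filter_not Finset.univ (fun i : Fin n => (i : ℕ) < r),
    Finset.sum_subtype (Finset.univ.filter fun i : Fin n => ¬ (i : ℕ) < r)
      (p := fun i : Fin n => ¬ (i : ℕ) < r) (by simp)]
  ring

end MazurHelpers

/-- Mazur's inequality. For every `b ∈ GL_n(L)` and every `O`-lattice
`M` in `N = Lⁿ`, one has `ν̄_b ≤ inv(M, Φ(M))` in the dominance order, where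
`(N, Φ) = (Lⁿ, b∘σ)`. Equivalently: for `μ ∈ (ℤⁿ)₊`, if there exists an `O`-lattice `M`
in `N` with `inv(M, Φ(M)) = μ`, then `ν̄_b ≤ μ`. -/
theorem mazur_inequality
    (p : ℕ) [Fact p.Prime] (k : Type) [Field k] [IsAlgClosed k] [CharP k p]
    (n : ℕ) (b : GL (Fin n) (K(p, k)))
    (ν : Fin n → ℚ) (hν : IsNewtonVector p k n b ν)
    (μ : Fin n → ℤ) (hμdom : ∀ i j : Fin n, i ≤ j → μ j ≤ μ i)
    (M : Submodule (WittVector p k) (Fin n → K(p, k)))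
    (hM : IsLattice p k n M)
    (hrel : RelPos p k n M (latImage p k n b M) μ) :
    DomLE n ν (fun i => (μ i : ℚ)) := by
  obtain ⟨e, he, hMe, hMe'⟩ := hrel
  obtain ⟨R, q, f, hR, hf, hq, hspan⟩ := newton_basis hν
  have hEu := colM_isUnit he
  have hFu := colM_isUnit hf
  -- the matrix identity for the lattice `M`
  have hEDu : IsUnit (colM fun i => (p : K(p, k)) ^ (μ i) • e i) := by
    rw [← colM_pDiag]
    refine hEu.mul ?_
    rw [Matrix.isUnit_iff_isUnit_det, pDiag, Matrix.det_diagonal, prod_zpow_p]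
    exact (zpow_ne_zero _ pL_ne).isUnit
  have hsp : Submodule.span (WittVector p k) (Set.range fun i => isocFrob p k n b (e i))
      = Submodule.span (WittVector p k) (Set.range fun i => (p : K(p, k)) ^ (μ i) • e i) := by
    rw [← hMe', latImage, hMe]
    have := span_iter b 1 (Set.range e)
    rw [Function.iterate_one] at this
    rw [this, ← Set.range_comp]
    rfl
  obtain ⟨Y, hYi, hYd, hY⟩ := colM_eq hEDu hsp
  have hE : PhiM b (colM e) = colM e * pDiag p k μ * Y := by
    rw [colM_pDiag, ← hY]
    exact PhiM_colM b e 1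
  -- the matrix identity for the slope decomposition
  have hFt : ∀ t : ℕ, ∃ Z : Matrix (Fin n) (Fin n) K(p, k), (∀ i j, InI p k 0 (Z i j)) ∧
      HasV p k 0 Z.det ∧
      colM f * pDiag p k (fun i => t * q i) = (PhiM b)^[R * t] (colM f) * Z := by
    intro t
    rw [colM_pDiag, PhiM_colM]
    refine colM_eq ?_ (hspan t)
    rw [← PhiM_colM, Matrix.isUnit_iff_isUnit_det, isUnit_iff_ne_zero]
    obtain ⟨c, hc⟩ := exists_HasV
      (((Matrix.isUnit_iff_isUnit_det _).1 b.isUnit).ne_zero)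
    obtain ⟨d, hd⟩ := exists_HasV (((Matrix.isUnit_iff_isUnit_det _).1 hFu).ne_zero)
    obtain ⟨u, hu⟩ := PhiM_det hc hd (R * t)
    rw [hu]
    refine mul_ne_zero (zpow_ne_zero _ pL_ne) ?_
    exact (u.isUnit.map (algebraMap (WittVector p k) K(p, k))).ne_zero
  have hR' : (0 : ℚ) < R := by exact_mod_cast hR
  have htot : ∑ i, ν i = ∑ i, (μ i : ℚ) := by
    obtain ⟨Z, -, hZ, h1⟩ := hFt 1
    simp only [Nat.cast_one, one_mul, mul_one] at h1
    have h2 := total_eq R hYd hE hEu hFu hZ h1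
    have h3 : (R : ℚ) * ∑ i, (μ i : ℚ) = ∑ i, (q i : ℚ) := by exact_mod_cast h2
    simp only [hq, ← Finset.mul_sum] at h3
    exact (mul_left_cancel₀ hR'.ne' h3).symm
  refine ⟨fun r hr => ?_, ?_⟩
  · rw [partialSum_eq, partialSum_eq, htot]
    have h1 := minors_le (ι := {i : Fin n // ¬ (i : ℕ) < r}) R (sum_tail_le hμdom hr) hYi hE
      hEu hFu (q := q) (fun t => by
        obtain ⟨Z, h1, -, h2⟩ := hFt t
        exact ⟨Z, h1, h2⟩) Subtype.val Subtype.val_injective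
    have h2 : (R : ℚ) * ∑ i : {i : Fin n // ¬ (i : ℕ) < r}, (μ i : ℚ)
        ≤ ∑ i : {i : Fin n // ¬ (i : ℕ) < r}, (q i : ℚ) := by exact_mod_cast h1
    simp only [hq, ← Finset.mul_sum] at h2
    have h3 := le_of_mul_le_mul_left h2 hR'
    linarith
  · have h : ∀ ξ : Fin n → ℚ, partialSum n ξ n = ∑ i, ξ i := by
      intro ξ
      simp [partialSum]
    rw [h, h, htot]
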